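/- For any covector X ∈ L(A,K) and any tope T of L(A,K), the set K_{X,T} = K ∩ ∩_{e : X_e=0} H_e^{T_e} is the unique connected component of K ∖ ∪_{e : X_e = 0} H_e containing F_T ∩ K. -/

import Mathlib

/-- Composition of sign vectors: `(X ∘ Y) e = X e` if `X e ≠ 0`, and `Y e` otherwise. -/
def scomp {E : Type*} (X Y : E → SignType) : E → SignType :=
  fun e => if X e = 0 then Y e else X e

/-- The partial order on sign vectors: `X ≤ Y` iff `X ∘ Y = Y`. -/
def sle {E : Type*} (X Y : E → SignType) : Prop := scomp X Y = Y

theorem sle_refl {E : Type*} (X : E → SignType) : sle X X := by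
  funext e; show (if X e = 0 then X e else X e) = X e; split <;> rfl

theorem sle_trans {E : Type*} {X Y Z : E → SignType} (h₁ : sle X Y) (h₂ : sle Y Z) :
    sle X Z := by
  funext e
  have h1 := congrFun h₁ e
  have h2 := congrFun h₂ e
  revert h1 h2
  show (if X e = 0 then Y e else X e) = Y e → (if Y e = 0 then Z e else Y e) = Z e →
    (if X e = 0 then Z e else X e) = Z e
  generalize X e = a; generalize Y e = b; generalize Z e = c
  revert a b c; decide

theorem sle_antisymm {E : Type*} {X Y : E → SignType} (h₁ : sle X Y) (h₂ : sle Y X) :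
    X = Y := by
  funext e
  have h1 := congrFun h₁ e
  have h2 := congrFun h₂ e
  revert h1 h2
  show (if X e = 0 then Y e else X e) = Y e → (if Y e = 0 then X e else Y e) = X e → X e = Y e
  generalize X e = a; generalize Y e = b
  revert a b; decide

/-- The separating set of two sign vectors: the indices where they take opposite
nonzero signs. -/
def SepSet {E : Type*} (X Y : E → SignType) : Set E :=
  {e | (X e = 1 ∧ Y e = -1) ∨ (X e = -1 ∧ Y e = 1)}

section Geometry

variable {E : Type*} {V : Type*} [NormedAddCommGroup V] [NormedSpace ℝ V]

/-- The face of a sign vector `X`, relative to the family of cooriented affine hyperplanes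
`H_e = {v | f e v = 0}`, with positive side `H_e⁺ = {v | f e v > 0}` and negative side
`H_e⁻ = {v | f e v < 0}`. -/
def face (f : E → (V →ᵃ[ℝ] ℝ)) (X : E → SignType) : Set V :=
  {v | ∀ e, SignType.sign (f e v) = X e}

/-- The conditional oriented matroid `L(A,K)`: the set of sign vectors whose face
meets `K`. -/
def covs (f : E → (V →ᵃ[ℝ] ℝ)) (K : Set V) : Set (E → SignType) :=
  {X | (face f X ∩ K).Nonempty}

/-- A tope of `L(A,K)`: a maximal covector. -/
def IsTope (f : E → (V →ᵃ[ℝ] ℝ)) (K : Set V) (T : E → SignType) : Prop :=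
  T ∈ covs f K ∧ ∀ Y ∈ covs f K, sle T Y → Y = T

/-- The set of topes of `L(A,K)`, as a type carrying the discrete topology. -/
def Topes (f : E → (V →ᵃ[ℝ] ℝ)) (K : Set V) : Type _ := {T : E → SignType // IsTope f K T}

instance (f : E → (V →ᵃ[ℝ] ℝ)) (K : Set V) : TopologicalSpace (Topes f K) := ⊥

instance (f : E → (V →ᵃ[ℝ] ℝ)) (K : Set V) : DiscreteTopology (Topes f K) := ⟨rfl⟩

/-- Points of `K × T(A,K)`. -/
abbrev ZPre (f : E → (V →ᵃ[ℝ] ℝ)) (K : Set V) : Type _ := K × Topes f K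

/-- The gluing relation defining `Z(A,K)`: `(v,T) ∼ (v',T')` iff `v = v'` and `v` lies on
no hyperplane separating `T` from `T'`. -/
def ZRel (f : E → (V →ᵃ[ℝ] ℝ)) (K : Set V) : ZPre f K → ZPre f K → Prop :=
  fun p q => (p.1 : V) = (q.1 : V) ∧ ∀ e ∈ SepSet p.2.1 q.2.1, f e (p.1 : V) ≠ 0

/-- The space `Z(A,K)`: one copy of `K` for each tope, glued along the complement of the
separating hyperplanes, with the quotient topology. -/
def ZSpace (f : E → (V →ᵃ[ℝ] ℝ)) (K : Set V) : Type _ := Quot (ZRel f K)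

instance (f : E → (V →ᵃ[ℝ] ℝ)) (K : Set V) : TopologicalSpace (ZSpace f K) :=
  inferInstanceAs (TopologicalSpace (Quot (ZRel f K)))

/-- The projection `π : Z(A,K) → V` (with image `K`), sending `[(v,T)]` to `v`. -/
def Zproj (f : E → (V →ᵃ[ℝ] ℝ)) (K : Set V) : ZSpace f K → V :=
  Quot.lift (fun p => (p.1 : V)) (fun _ _ h => h.1)

/-- The set `K_{X,T} = K ∩ ⋂_{e : X_e = 0} H_e^{T_e}`. -/
def KXT (f : E → (V →ᵃ[ℝ] ℝ)) (K : Set V) (X T : E → SignType) : Set V :=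
  K ∩ ⋂ e ∈ {e | X e = 0}, {v | SignType.sign (f e v) = T e}

/-- The subset `U_{X,T} ⊆ Z(A,K)`: the image of `K_{X,T} × {T}` under the quotient map. -/
def UXT (f : E → (V →ᵃ[ℝ] ℝ)) (K : Set V) (X : E → SignType) (T : Topes f K) :
    Set (ZSpace f K) :=
  {z | ∃ (v : V) (hv : v ∈ K), v ∈ KXT f K X T.1 ∧ z = Quot.mk (ZRel f K) (⟨v, hv⟩, T)}

/-- The complexified complement `M(A,K)`, where `V ⊗ ℂ` is modeled as `V × V` (real and
imaginary parts): `v + iw` lies on `H_e ⊗ ℂ` iff `f e v = 0` and the linear part of `f e`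
vanishes on `w`. -/
def MSpace (f : E → (V →ᵃ[ℝ] ℝ)) (K : Set V) : Type _ :=
  {p : V × V // p.1 ∈ K ∧ ∀ e, ¬(f e p.1 = 0 ∧ (f e).linear p.2 = 0)}

instance (f : E → (V →ᵃ[ℝ] ℝ)) (K : Set V) : TopologicalSpace (MSpace f K) :=
  inferInstanceAs (TopologicalSpace {p : V × V // p.1 ∈ K ∧ _})

/-- The projection `ρ : M(A,K) → V` (with image `K`), sending `v + iw` to `v`. -/
def Mproj (f : E → (V →ᵃ[ℝ] ℝ)) (K : Set V) : MSpace f K → V := fun p => p.1.1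

end Geometry

variable {V : Type*} [NormedAddCommGroup V] [NormedSpace ℝ V] [FiniteDimensional ℝ V]
variable {E : Type*} [Fintype E]

/-- Every tope of an arrangement restricted to an open set has full support. -/
theorem IsTope.apply_ne_zero {E V : Type*} [Finite E] [NormedAddCommGroup V] [NormedSpace ℝ V]
    {f : E → (V →ᵃ[ℝ] ℝ)} (hf : ∀ e, (f e).linear ≠ 0) {K : Set V} (hK : IsOpen K)
    {T : E → SignType} (hT : IsTope f K T) (e : E) : T e ≠ 0 := by
  intro he
  obtain ⟨⟨p, hpT, hpK⟩, hmax⟩ := hT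
  obtain ⟨w, hw⟩ : ∃ w, (f e).linear w ≠ 0 := by
    by_contra! h
    exact hf e (LinearMap.ext h)
  have hline : ∀ e' (t : ℝ), f e' (p + t • w) = f e' p + t * (f e').linear w := by
    intro e' t
    have h := (f e').map_vadd p (t • w)
    simp only [vadd_eq_add, map_smul, smul_eq_mul] at h
    rw [add_comm p, h, add_comm]
  have hmem : ∀ᶠ t : ℝ in nhds 0, p + t • w ∈ K := by
    have hc : Continuous fun t : ℝ => p + t • w := by fun_prop
    exact hc.continuousAt.eventually_mem (hK.mem_nhds (by simpa using hpK))
  have hsign : ∀ᶠ t : ℝ in nhds 0, ∀ e', f e' p ≠ 0 →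
      SignType.sign (f e' (p + t • w)) = SignType.sign (f e' p) := by
    rw [Filter.eventually_all]
    intro e'
    by_cases h0 : f e' p = 0
    · simp [h0]
    have hc : Continuous fun t : ℝ => f e' p + t * (f e').linear w := by fun_prop
    rcases lt_or_gt_of_ne h0 with h | h
    · filter_upwards [hc.continuousAt.eventually_lt continuousAt_const
        (show f e' p + 0 * (f e').linear w < 0 by simpa using h)] with t ht _
      rw [hline, sign_neg ht, sign_neg h]
    · filter_upwards [continuousAt_const.eventually_lt hc.continuousAt
        (show 0 < f e' p + 0 * (f e').linear w by simpa using h)] with t ht _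
      rw [hline, sign_pos ht, sign_pos h]
  obtain ⟨t, ⟨htK, hts⟩, ht0⟩ :=
    (((hmem.and hsign).filter_mono nhdsWithin_le_nhds).and
      (self_mem_nhdsWithin : {t : ℝ | t ≠ 0} ∈ nhdsWithin (0 : ℝ) {0}ᶜ)).exists
  have hY := hmax (fun e' => SignType.sign (f e' (p + t • w))) ⟨_, fun _ => rfl, htK⟩ <| by
    funext e'
    simp only [scomp]
    split_ifs with h
    · rfl
    · rw [← hpT e'] at h ⊢
      exact (hts e' (sign_ne_zero.mp h)).symm
  have hp0 : f e p = 0 := sign_eq_zero_iff.mp ((hpT e).trans he)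
  have h := (congrFun hY e).trans he
  rw [sign_eq_zero_iff, hline, hp0, zero_add] at h
  exact mul_ne_zero ht0 hw h

/-- A continuous real function without zeros on a preconnected set has constant sign there. -/
theorem IsPreconnected.sign_eq {α : Type*} [TopologicalSpace α] {s : Set α}
    (hs : IsPreconnected s) {g : α → ℝ} (hg : ContinuousOn g s) (h0 : ∀ x ∈ s, g x ≠ 0)
    {x y : α} (hx : x ∈ s) (hy : y ∈ s) : SignType.sign (g x) = SignType.sign (g y) :=
  hs.constant (f := fun z => SignType.sign (g z))
    (fun z hz => (continuousAt_sign_of_ne_zero (h0 z hz)).comp_continuousWithinAt (hg z hz)) hx hy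

/-- The points where an affine function has a prescribed nonzero sign form a convex set. -/
theorem AffineMap.convex_setOf_sign_eq {V : Type*} [AddCommGroup V] [Module ℝ V]
    (g : V →ᵃ[ℝ] ℝ) {s : SignType} (hs : s ≠ 0) : Convex ℝ {v | SignType.sign (g v) = s} := by
  cases s with
  | zero => exact absurd rfl hs
  | neg => simpa [Set.preimage, ← sign_eq_neg_one_iff] using (convex_Iio (0 : ℝ)).affine_preimage g
  | pos => simpa [Set.preimage, ← sign_eq_one_iff] using (convex_Ioi (0 : ℝ)).affine_preimage g

/-- If `T` has no zero entries, then `KXT f K X T` is the component of each of its points. -/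
theorem connectedComponentIn_eq_KXT {E V : Type*} [NormedAddCommGroup V] [NormedSpace ℝ V]
    [FiniteDimensional ℝ V] {f : E → (V →ᵃ[ℝ] ℝ)} {K : Set V} (hK : Convex ℝ K)
    {X T : E → SignType} (hT : ∀ e, T e ≠ 0) {p : V} (hp : p ∈ KXT f K X T) :
    p ∈ K \ ⋃ e ∈ {e | X e = 0}, {w | f e w = 0} ∧
      connectedComponentIn (K \ ⋃ e ∈ {e | X e = 0}, {w | f e w = 0}) p = KXT f K X T := by
  have hsub : KXT f K X T ⊆ K \ ⋃ e ∈ {e | X e = 0}, {w | f e w = 0} := by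
    rintro v ⟨hvK, hv⟩
    refine ⟨hvK, fun hmem => ?_⟩
    simp only [Set.mem_iUnion, Set.mem_iInter, Set.mem_ofPred_eq] at hmem hv
    obtain ⟨e, he, h0⟩ := hmem
    exact hT e (by rw [← hv e he, h0, sign_zero])
  have hconv : Convex ℝ (KXT f K X T) :=
    hK.inter (convex_iInter₂ fun e _ => (f e).convex_setOf_sign_eq (hT e))
  refine ⟨hsub hp, subset_antisymm (fun v hv => ?_)
    (hconv.isPreconnected.subset_connectedComponentIn hp hsub)⟩
  refine ⟨(connectedComponentIn_subset _ _ hv).1, Set.mem_iInter₂.mpr fun e he => ?_⟩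
  refine (isPreconnected_connectedComponentIn.sign_eq
    (f e).continuous_of_finiteDimensional.continuousOn (fun x hx h0 => ?_) hv
    (mem_connectedComponentIn (hsub hp))).trans (Set.mem_iInter₂.mp hp.2 e he)
  exact (connectedComponentIn_subset _ _ hx).2 (Set.mem_biUnion he h0)

/-- For any covector `X ∈ L(A,K)` and tope `T` of `L(A,K)`, the set
`K_{X,T} = K ∩ ⋂_{e : X_e = 0} H_e^{T_e}` is the unique connected component of
`K ∖ ⋃_{e : X_e = 0} H_e` containing `F_T ∩ K`. -/
theorem KXT_unique_component
    (f : E → (V →ᵃ[ℝ] ℝ)) (hf : ∀ e, (f e).linear ≠ 0)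
    (K : Set V) (hKne : K.Nonempty) (hKconv : Convex ℝ K) (hKopen : IsOpen K)
    (X : E → SignType) (hX : X ∈ covs f K)
    (T : E → SignType) (hT : IsTope f K T) :
    KXT f K X T ∈ {Comp : Set V | ∃ v ∈ K \ ⋃ e ∈ {e | X e = 0}, {w | f e w = 0},
        Comp = connectedComponentIn (K \ ⋃ e ∈ {e | X e = 0}, {w | f e w = 0}) v} ∧
    face f T ∩ K ⊆ KXT f K X T ∧
    ∀ Comp ∈ {Comp : Set V | ∃ v ∈ K \ ⋃ e ∈ {e | X e = 0}, {w | f e w = 0},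
        Comp = connectedComponentIn (K \ ⋃ e ∈ {e | X e = 0}, {w | f e w = 0}) v},
      face f T ∩ K ⊆ Comp → Comp = KXT f K X T := by
  have hsub : face f T ∩ K ⊆ KXT f K X T := fun v hv =>
    ⟨hv.2, Set.mem_iInter₂.mpr fun e _ => hv.1 e⟩
  obtain ⟨p, hp⟩ := hT.1
  obtain ⟨hpS, hcomp⟩ :=
    connectedComponentIn_eq_KXT hKconv (hT.apply_ne_zero hf hKopen) (hsub hp)
  refine ⟨⟨p, hpS, hcomp.symm⟩, hsub, ?_⟩
  rintro _ ⟨v, -, rfl⟩ hface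
  rw [connectedComponentIn_eq (hface hp), hcomp]
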